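/- arXiv:2308.11393 — 2 statements merged into one kernel-verified Lean document; each statement's English description precedes it below -/
import Mathlib

section
/- Assume (C3) and (C4) and let α ∈ (0, α_max). Then lim_{t → 0} (1/t) ρ_H(R(α+t), R(α)) = 1 / min_{x ∈ ∂R(α)} T_{x,u_x}μ, where u_x = ∇D(x)/‖∇D(x)‖ is the outer unit normal of the unique minimal halfspace at x ∈ ∂R(α). -/
open MeasureTheory Filter Set
open scoped RealInnerProductSpace ENNReal Topology

noncomputable section

/-- A closed halfspace of `ℝ^d`. -/
def IsHalfspace {d : ℕ} (H : Set (EuclideanSpace ℝ (Fin d))) : Prop :=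
  ∃ (u : EuclideanSpace ℝ (Fin d)) (t : ℝ), ‖u‖ = 1 ∧ H = {z | ⟪z, u⟫ ≤ t}

/-- The halfspace (Tukey) depth of a point `x` with respect to `μ`. -/
def halfspaceDepth {d : ℕ} (μ : Measure (EuclideanSpace ℝ (Fin d)))
    (x : EuclideanSpace ℝ (Fin d)) : ℝ :=
  sInf {r | ∃ H, IsHalfspace H ∧ x ∈ H ∧ r = (μ H).toReal}

/-- The depth trimmed region at level `α`. -/
def trimmedRegion {d : ℕ} (μ : Measure (EuclideanSpace ℝ (Fin d))) (α : ℝ) :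
    Set (EuclideanSpace ℝ (Fin d)) :=
  {x | α ≤ halfspaceDepth μ x}

/-- The maximal depth `α_max`. -/
def depthMax {d : ℕ} (μ : Measure (EuclideanSpace ℝ (Fin d))) : ℝ :=
  ⨆ x, halfspaceDepth μ x

/-- Condition (C3): the depth function is continuously differentiable in a neighbourhood of
`∂R(α)` with non-vanishing gradient on `∂R(α)`. -/
def CondC3 {d : ℕ} (μ : Measure (EuclideanSpace ℝ (Fin d))) (α : ℝ) : Prop :=
  (∃ U : Set (EuclideanSpace ℝ (Fin d)), IsOpen U ∧
    frontier (trimmedRegion μ α) ⊆ U ∧ ContDiffOn ℝ 1 (halfspaceDepth μ) U) ∧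
  ∀ x ∈ frontier (trimmedRegion μ α), gradient (halfspaceDepth μ) x ≠ 0

/-- Condition (C4): for every unit vector `u` the projection of `μ` on the direction `u`
has density `f u` which is jointly continuous and positive strictly between the essential
bounds of the support of the projection. -/
def CondC4 {d : ℕ} (μ : Measure (EuclideanSpace ℝ (Fin d)))
    (f : EuclideanSpace ℝ (Fin d) → ℝ → ℝ) : Prop :=
  (∀ u : EuclideanSpace ℝ (Fin d), ‖u‖ = 1 →
    μ.map (fun z => ⟪z, u⟫) =
      (volume : Measure ℝ).withDensity (fun t => ENNReal.ofReal (f u t))) ∧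
  ContinuousOn (fun p : EuclideanSpace ℝ (Fin d) × ℝ => f p.1 p.2)
    ((Metric.sphere (0 : EuclideanSpace ℝ (Fin d)) 1) ×ˢ (Set.univ : Set ℝ)) ∧
  (∀ u : EuclideanSpace ℝ (Fin d), ‖u‖ = 1 → ∀ t : ℝ,
    0 < μ.map (fun z => ⟪z, u⟫) (Set.Iio t) →
    0 < μ.map (fun z => ⟪z, u⟫) (Set.Ioi t) → 0 < f u t)

/-- The outer unit normal `u_x = ∇D(x)/‖∇D(x)‖` of the minimal halfspace at `x`. -/
def outerNormal {d : ℕ} (μ : Measure (EuclideanSpace ℝ (Fin d)))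
    (x : EuclideanSpace ℝ (Fin d)) : EuclideanSpace ℝ (Fin d) :=
  ‖gradient (halfspaceDepth μ) x‖⁻¹ • gradient (halfspaceDepth μ) x

/-- The Radon-transform type quantity `T_{x,u}μ = f_u(⟨x,u⟩)`. -/
def radonT {d : ℕ} (f : EuclideanSpace ℝ (Fin d) → ℝ → ℝ)
    (x u : EuclideanSpace ℝ (Fin d)) : ℝ :=
  f u ⟪x, u⟫

/-- Near a point with derivative of norm larger than `c`, the values of `D` can be increased at
rate `c`, uniformly in the base point. -/
lemma eventually_exists_add_mul_le {E : Type*} [NormedAddCommGroup E] [NormedSpace ℝ E]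
    {D : E → ℝ} {D' : E →L[ℝ] ℝ} {x : E} {c : ℝ} (hD : HasStrictFDerivAt D D' x)
    (hc : c < ‖D'‖) :
    ∀ᶠ p : ℝ × E in 𝓝 (0, x), 0 ≤ p.1 → ∃ y, dist p.2 y ≤ p.1 ∧ D p.2 + c * p.1 ≤ D y := by
  obtain ⟨v, hv1, hv⟩ : ∃ v, ‖v‖ < 1 ∧ c < D' v := by
    obtain ⟨v, hv1, hv⟩ := D'.exists_lt_apply_of_lt_opNorm hc
    rw [Real.norm_eq_abs] at hv
    rcases lt_abs.1 hv with h | h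
    · exact ⟨v, hv1, h⟩
    · exact ⟨-v, by rwa [norm_neg], by rwa [map_neg]⟩
  have hlo := hD.isLittleO.def (sub_pos.2 hv)
  have htend : Tendsto (fun p : ℝ × E => (p.2 + p.1 • v, p.2)) (𝓝 (0, x)) (𝓝 (x, x)) := by
    have : Continuous fun p : ℝ × E => (p.2 + p.1 • v, p.2) := by fun_prop
    simpa using this.tendsto (0, x)
  filter_upwards [htend.eventually hlo] with p hp hr
  have hle : p.1 * ‖v‖ ≤ p.1 := mul_le_of_le_one_right hr hv1.le
  refine ⟨p.2 + p.1 • v, ?_, ?_⟩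
  · simpa [norm_smul, abs_of_nonneg hr] using hle
  · simp only [add_sub_cancel_left, map_smul, smul_eq_mul, norm_smul, Real.norm_eq_abs,
      abs_of_nonneg hr] at hp
    have h1 := (abs_le.1 hp).1
    nlinarith [mul_le_mul_of_nonneg_left hle (sub_pos.2 hv).le]

/-- Uniform upper bound for the distance between superlevel sets at close levels. -/
lemma eventually_superlevel_dist_le {E : Type*} [NormedAddCommGroup E] [NormedSpace ℝ E]
    {D : E → ℝ} {α b c : ℝ} (hD : Continuous D) (hb : b < α) (hK : IsCompact {x | b ≤ D x})
    (hD' : ∀ x, D x = α → HasStrictFDerivAt D (fderiv ℝ D x) x)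
    (hc0 : 0 < c) (hc : ∀ x, D x = α → c < ‖fderiv ℝ D x‖) :
    ∃ δ > 0, ∀ β γ, α - δ < β → β ≤ γ → γ < α + δ →
      ∀ x, β ≤ D x → ∃ y, γ ≤ D y ∧ dist x y ≤ (γ - β) / c := by
  have hlevel : IsCompact {x | D x = α} :=
    hK.of_isClosed_subset (isClosed_eq hD continuous_const)
      fun x (hx : D x = α) => hb.le.trans hx.ge
  have hprod : ∀ᶠ p : ℝ × E in 𝓝 (0 : ℝ) ×ˢ 𝓝ˢ {x | D x = α},
      0 ≤ p.1 → ∃ y, dist p.2 y ≤ p.1 ∧ D p.2 + c * p.1 ≤ D y := by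
    rw [← nhdsSet_singleton, ← isCompact_singleton.nhdsSet_prod_eq hlevel,
      eventually_nhdsSet_iff_forall]
    rintro ⟨r, x⟩ ⟨hr, hx⟩
    obtain rfl : r = 0 := hr
    exact eventually_exists_add_mul_le (hD' x hx) (hc x hx)
  obtain ⟨P, hP, Q, hQ, hPQ⟩ := eventually_prod_iff.1 hprod
  obtain ⟨r, hr, hPr⟩ := Metric.eventually_nhds_iff.1 hP
  obtain ⟨V, hVo, hV, hQV⟩ := eventually_nhdsSet_iff_exists.1 hQ
  obtain ⟨η, hη, hηV⟩ : ∃ η > 0, ∀ x, b ≤ D x → |D x - α| < η → x ∈ V := by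
    have hcpt : IsCompact ({x | b ≤ D x} \ V) := hK.diff hVo
    rcases ({x | b ≤ D x} \ V).eq_empty_or_nonempty with he | hne
    · refine ⟨1, one_pos, fun x hx _ => ?_⟩
      by_contra hxV
      exact (he ▸ (⟨hx, hxV⟩ : x ∈ {x | b ≤ D x} \ V) : x ∈ (∅ : Set E))
    · obtain ⟨z, hz, hmin⟩ := hcpt.exists_isMinOn hne
        (f := fun x => |D x - α|) (by fun_prop)
      refine ⟨|D z - α|, abs_pos.2 fun h => hz.2 (hV (sub_eq_zero.1 h)), fun x hx hlt => ?_⟩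
      by_contra hxV
      exact absurd (hmin ⟨hx, hxV⟩) (not_le.2 hlt)
  refine ⟨min (min η (α - b)) (r * c / 2), by have := sub_pos.2 hb; positivity,
    fun β γ hβ hβγ hγ x hx => ?_⟩
  have hδ1 : min (min η (α - b)) (r * c / 2) ≤ η := (min_le_left _ _).trans (min_le_left _ _)
  have hδ2 : min (min η (α - b)) (r * c / 2) ≤ α - b :=
    (min_le_left _ _).trans (min_le_right _ _)
  have hδ3 : min (min η (α - b)) (r * c / 2) ≤ r * c / 2 := min_le_right _ _
  have hnonneg : 0 ≤ (γ - β) / c := div_nonneg (sub_nonneg.2 hβγ) hc0.le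
  rcases le_or_gt γ (D x) with h | h
  · exact ⟨x, h, by simpa using hnonneg⟩
  · have hxV : x ∈ V := hηV x (by linarith) (abs_lt.2 ⟨by linarith, by linarith⟩)
    obtain ⟨y, hy, hDy⟩ := hPQ (x := (γ - β) / c) (y := x)
      (hPr (by
        rw [Real.dist_eq, sub_zero, abs_of_nonneg hnonneg, div_lt_iff₀ hc0]
        linarith)) (hQV x hxV) hnonneg
    refine ⟨y, ?_, hy⟩
    simp only [mul_div_cancel₀ _ hc0.ne'] at hDy
    linarith

/-- Lower bound for the distance between superlevel sets at close levels. -/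
lemma eventually_le_superlevel_dist {E : Type*} [NormedAddCommGroup E] [NormedSpace ℝ E]
    {D : E → ℝ} {α c : ℝ} {x₀ : E} (hD : Continuous D) (hx₀ : D x₀ = α)
    (hfr : x₀ ∈ frontier {x | α ≤ D x})
    (hD' : HasStrictFDerivAt D (fderiv ℝ D x₀) x₀) (hc : ‖fderiv ℝ D x₀‖ < c) :
    ∃ δ > 0, ∀ β γ, α - δ < β → β ≤ α → β ≤ γ → γ < β + δ →
      ∃ y, β ≤ D y ∧ ∀ z, γ ≤ D z → (γ - β) / c ≤ dist y z := by
  have hc0 : 0 < c := (norm_nonneg _).trans_lt hc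
  obtain ⟨S, hS, hLip⟩ := hD'.exists_lipschitzOnWith_of_nnnorm_lt ⟨c, hc0.le⟩ hc
  obtain ⟨r, hr, hrS⟩ := Metric.mem_nhds_iff.1 hS
  have hr2 : 0 < r / 2 := half_pos hr
  obtain ⟨w, hwb, hw⟩ : ∃ w ∈ Metric.ball x₀ (r / 2), D w < α := by
    have := hfr.2
    rw [mem_interior_iff_mem_nhds, Metric.mem_nhds_iff] at this
    push Not at this
    obtain ⟨w, hw, hw'⟩ := not_subset.1 (this (r / 2) hr2)
    exact ⟨w, hw, not_le.1 hw'⟩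
  refine ⟨min (α - D w) (c * (r / 2)), lt_min (sub_pos.2 hw) (by positivity),
    fun β γ hβ hβα hβγ hγ => ?_⟩
  have hδ1 := min_le_left (α - D w) (c * (r / 2))
  have hδ2 := min_le_right (α - D w) (c * (r / 2))
  obtain ⟨y, hy, hDy⟩ := (convex_ball x₀ (r / 2)).isPreconnected.intermediate_value hwb
    (Metric.mem_ball_self hr2) hD.continuousOn
    (show β ∈ Icc (D w) (D x₀) from ⟨by linarith, by linarith⟩)
  rw [Metric.mem_ball] at hy
  refine ⟨y, hDy.ge, fun z hz => ?_⟩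
  rw [div_le_iff₀ hc0]
  rcases lt_or_ge (dist y z) (r / 2) with h | h
  · have hyS : y ∈ S := hrS (Metric.mem_ball.2 (by linarith))
    have hzS : z ∈ S := hrS (Metric.mem_ball.2 (by
      have := dist_triangle_left z x₀ y
      linarith))
    have := hLip.dist_le_mul z hzS y hyS
    rw [Real.dist_eq, dist_comm z y] at this
    have := (le_abs_self _).trans this
    change D z - D y ≤ c * dist y z at this
    linarith
  · nlinarith

/-- Rate of change, in the Hausdorff distance, of the superlevel sets of a function at a
regular level. -/
theorem tendsto_hausdorffDist_superlevel_div {E : Type*} [NormedAddCommGroup E]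
    [NormedSpace ℝ E] {D : E → ℝ} {α b m : ℝ} {x₀ : E} (hD : Continuous D) (hb : b < α)
    (hK : IsCompact {x | b ≤ D x}) (hα : ∃ x, α < D x)
    (hD' : ∀ x, D x = α → HasStrictFDerivAt D (fderiv ℝ D x) x)
    (hm0 : 0 < m) (hm : ∀ x, D x = α → m ≤ ‖fderiv ℝ D x‖)
    (hx₀ : D x₀ = α) (hfr : x₀ ∈ frontier {x | α ≤ D x}) (hx₀m : ‖fderiv ℝ D x₀‖ = m) :
    Tendsto (fun t : ℝ => Metric.hausdorffDist {x | α + t ≤ D x} {x | α ≤ D x} / |t|)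
      (𝓝[≠] 0) (𝓝 (1 / m)) := by
  obtain ⟨p, hp⟩ := hα
  have hbdd : ∀ β, b ≤ β → Bornology.IsBounded {x | β ≤ D x} := fun β hβ =>
    hK.isBounded.subset fun x (hx : β ≤ D x) => hβ.trans hx
  have hsmall : ∀ δ > 0, ∀ᶠ t : ℝ in 𝓝[≠] 0, |t| < δ ∧ t ≠ 0 := fun δ hδ => by
    refine Filter.Eventually.and ?_ self_mem_nhdsWithin
    refine nhdsWithin_le_nhds (Metric.eventually_nhds_iff.2 ⟨δ, hδ, fun t ht => ?_⟩)
    simpa [Real.dist_eq] using ht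
  have hcont : ∀ s : ℝ, Tendsto (fun ε : ℝ => 1 / (m + s * ε)) (𝓝[>] 0) (𝓝 (1 / m)) := fun s => by
    have : ContinuousAt (fun ε : ℝ => 1 / (m + s * ε)) 0 := by
      refine ContinuousAt.div (by fun_prop) (by fun_prop) (by simpa using hm0.ne')
    simpa using this.tendsto.mono_left nhdsWithin_le_nhds
  refine tendsto_order.2 ⟨fun a ha => ?_, fun a ha => ?_⟩
  · obtain ⟨ε, hεa, hε⟩ := (((hcont 1).eventually (lt_mem_nhds ha)).and self_mem_nhdsWithin).exists
    rw [one_mul] at hεa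
    replace hε : 0 < ε := hε
    obtain ⟨δ, hδ, H⟩ := eventually_le_superlevel_dist hD hx₀ hfr (hD' x₀ hx₀)
      (c := m + ε) (by linarith)
    filter_upwards [hsmall _ (lt_min hδ (lt_min (sub_pos.2 hb) (sub_pos.2 hp)))]
      with t ⟨ht, ht0⟩
    obtain ⟨ht1, ht⟩ := lt_min_iff.1 ht
    obtain ⟨ht2, ht3⟩ := lt_min_iff.1 ht
    rw [abs_lt] at ht1 ht2 ht3
    have htop : Metric.hausdorffEDist {x | α + t ≤ D x} {x | α ≤ D x} ≠ ⊤ :=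
      Metric.hausdorffEDist_ne_top_of_nonempty_of_bounded
        ⟨p, by rw [mem_ofPred_eq]; linarith⟩ ⟨p, hp.le⟩
        (hbdd _ (by linarith)) (hbdd _ hb.le)
    refine hεa.trans_le ?_
    rw [le_div_iff₀ (abs_pos.2 ht0), one_div_mul_eq_div]
    rcases le_or_gt 0 t with h | h
    · obtain ⟨y, hy, hyz⟩ := H α (α + t) (by linarith) le_rfl (by linarith) (by linarith)
      rw [Metric.hausdorffDist_comm]
      rw [Metric.hausdorffEDist_comm] at htop
      refine le_trans ?_ (Metric.infDist_le_hausdorffDist_of_mem (x := y) hy htop)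
      refine (Metric.le_infDist ⟨p, by rw [mem_ofPred_eq]; linarith⟩).2 fun z hz => ?_
      simpa [abs_of_nonneg h] using hyz z hz
    · obtain ⟨y, hy, hyz⟩ := H (α + t) α (by linarith) (by linarith) (by linarith) (by linarith)
      refine le_trans ?_ (Metric.infDist_le_hausdorffDist_of_mem (x := y) hy htop)
      refine (Metric.le_infDist ⟨p, hp.le⟩).2 fun z hz => ?_
      simpa [abs_of_neg h] using hyz z hz
  · obtain ⟨ε, ⟨hεa, hεm⟩, hε⟩ := ((((hcont (-1)).eventually (gt_mem_nhds ha)).and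
      (nhdsWithin_le_nhds (gt_mem_nhds hm0))).and self_mem_nhdsWithin).exists
    rw [neg_one_mul, ← sub_eq_add_neg] at hεa
    replace hε : 0 < ε := hε
    obtain ⟨δ, hδ, H⟩ := eventually_superlevel_dist_le hD hb hK hD' (sub_pos.2 hεm)
      fun x hx => (sub_lt_self m hε).trans_le (hm x hx)
    filter_upwards [hsmall δ hδ] with t ⟨ht, ht0⟩
    rw [abs_lt] at ht
    have hnonneg : 0 ≤ |t| / (m - ε) := div_nonneg (abs_nonneg t) (sub_pos.2 hεm).le
    refine lt_of_le_of_lt ?_ hεa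
    rw [div_le_iff₀ (abs_pos.2 ht0), one_div_mul_eq_div]
    rcases le_or_gt 0 t with h | h
    · refine Metric.hausdorffDist_le_of_mem_dist hnonneg (fun x (hx : α + t ≤ D x) =>
        ⟨x, by rw [mem_ofPred_eq]; linarith, by simpa using hnonneg⟩) fun x hx => ?_
      simpa [abs_of_nonneg h] using H α (α + t) (by linarith) (by linarith) (by linarith) x hx
    · refine Metric.hausdorffDist_le_of_mem_dist hnonneg (fun x hx => ?_) fun x (hx : α ≤ D x) =>
        ⟨x, by rw [mem_ofPred_eq]; linarith, by simpa using hnonneg⟩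
      simpa [abs_of_neg h] using H (α + t) α (by linarith) (by linarith) (by linarith) x hx

/-- The distribution function of a finite measure with continuous density `g` has derivative
`max g 0`. -/
lemma hasDerivAt_measure_Iic {ν : Measure ℝ} [IsFiniteMeasure ν] {g : ℝ → ℝ}
    (hg : Continuous g)
    (hν : ν = (volume : Measure ℝ).withDensity fun t => ENNReal.ofReal (g t)) (c : ℝ) :
    HasDerivAt (fun t => (ν (Iic t)).toReal) (max (g c) 0) c := by
  have hcont : Continuous fun x => max (g x) 0 := hg.max continuous_const
  have hofReal : ∀ x, ENNReal.ofReal (max (g x) 0) = ENNReal.ofReal (g x) := fun x => by simp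
  have hint : Integrable (fun x => max (g x) 0) := by
    refine ⟨hcont.aestronglyMeasurable, ?_⟩
    rw [hasFiniteIntegral_iff_ofReal (Eventually.of_forall fun x => le_max_right (g x) 0)]
    simp_rw [hofReal]
    rw [← setLIntegral_univ, ← withDensity_apply _ MeasurableSet.univ, ← hν]
    exact measure_lt_top ν _
  have hF : ∀ t, (ν (Iic t)).toReal = ∫ x in Iic t, max (g x) 0 := fun t => by
    rw [integral_eq_lintegral_of_nonneg_ae (Eventually.of_forall fun x => le_max_right (g x) 0)
      hcont.aestronglyMeasurable, hν, withDensity_apply _ measurableSet_Iic]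
    simp_rw [hofReal]
  have hF' : (fun t => (ν (Iic t)).toReal) =
      fun t => (∫ x in Iic c, max (g x) 0) + ∫ x in c..t, max (g x) 0 := by
    funext t
    rw [hF, ← intervalIntegral.integral_Iic_sub_Iic hint.integrableOn hint.integrableOn]
    ring
  rw [hF']
  exact (intervalIntegral.integral_hasDerivAt_right (hcont.intervalIntegrable _ _)
    (hcont.stronglyMeasurableAtFilter _ _) hcont.continuousAt).const_add _

section Depth

variable {d : ℕ} {μ : Measure (EuclideanSpace ℝ (Fin d))}
  {f : EuclideanSpace ℝ (Fin d) → ℝ → ℝ}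

lemma CondC4.continuous_density (h : CondC4 μ f) {u : EuclideanSpace ℝ (Fin d)}
    (hu : ‖u‖ = 1) : Continuous (f u) := by
  have : Continuous fun t : ℝ => (u, t) := by fun_prop
  exact h.2.1.comp_continuous this fun t => ⟨by simpa using hu, mem_univ t⟩

lemma CondC4.measure_hyperplane (h : CondC4 μ f) {u : EuclideanSpace ℝ (Fin d)}
    (hu : ‖u‖ = 1) (c : ℝ) : μ {z | ⟪z, u⟫ = c} = 0 := by
  have hm : Measurable fun z : EuclideanSpace ℝ (Fin d) => ⟪z, u⟫ := by fun_prop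
  have : μ.map (fun z => ⟪z, u⟫) {c} = 0 := by
    rw [h.1 u hu]
    exact withDensity_absolutelyContinuous _ _ (measure_singleton c)
  rwa [Measure.map_apply hm (measurableSet_singleton c)] at this

lemma halfspaceDepth_eq_sInf_sphere [IsProbabilityMeasure μ] (x : EuclideanSpace ℝ (Fin d)) :
    halfspaceDepth μ x = sInf ((fun u : Metric.sphere (0 : EuclideanSpace ℝ (Fin d)) 1 =>
      μ.real {z | ⟪z, u.1⟫ ≤ ⟪x, u.1⟫}) '' univ) := by
  unfold halfspaceDepth
  rcases isEmpty_or_nonempty (Metric.sphere (0 : EuclideanSpace ℝ (Fin d)) 1) with he | ⟨⟨u₀⟩⟩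
  · congr 1
    ext r
    simp only [mem_ofPred_eq, image_univ, mem_range, IsEmpty.exists_iff, iff_false]
    rintro ⟨H, ⟨u, t, hu, -⟩, -⟩
    exact he.elim ⟨u, by simpa using hu⟩
  · have hbdd : BddBelow {r | ∃ H, IsHalfspace H ∧ x ∈ H ∧ r = (μ H).toReal} :=
      ⟨0, by rintro _ ⟨H, -, -, rfl⟩; positivity⟩
    have hbdd' : BddBelow ((fun u : Metric.sphere (0 : EuclideanSpace ℝ (Fin d)) 1 =>
        μ.real {z | ⟪z, u.1⟫ ≤ ⟪x, u.1⟫}) '' univ) :=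
      ⟨0, by rintro _ ⟨u, -, rfl⟩; positivity⟩
    have hmem : ∀ u : Metric.sphere (0 : EuclideanSpace ℝ (Fin d)) 1,
        μ.real {z | ⟪z, u.1⟫ ≤ ⟪x, u.1⟫} ∈
          {r | ∃ H, IsHalfspace H ∧ x ∈ H ∧ r = (μ H).toReal} := fun u =>
      ⟨{z | ⟪z, u.1⟫ ≤ ⟪x, u.1⟫}, ⟨u.1, _, by simp, rfl⟩, le_refl ⟪x, u.1⟫, rfl⟩
    refine le_antisymm (le_csInf ⟨_, u₀, mem_univ _, rfl⟩ ?_) (le_csInf ⟨_, hmem u₀⟩ ?_)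
    · rintro _ ⟨u, -, rfl⟩
      exact csInf_le hbdd (hmem u)
    · rintro _ ⟨_, ⟨u, t, hu, rfl⟩, hx, rfl⟩
      refine (csInf_le hbdd' ⟨⟨u, by simpa using hu⟩, mem_univ _, rfl⟩).trans ?_
      exact measureReal_mono fun z (hz : ⟪z, u⟫ ≤ ⟪x, u⟫) => hz.trans hx

lemma halfspaceDepth_le (x : EuclideanSpace ℝ (Fin d)) {u : EuclideanSpace ℝ (Fin d)}
    (hu : ‖u‖ = 1) : halfspaceDepth μ x ≤ μ.real {z | ⟪z, u⟫ ≤ ⟪x, u⟫} :=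
  csInf_le ⟨0, by rintro _ ⟨H, -, -, rfl⟩; positivity⟩
    ⟨_, ⟨u, _, hu, rfl⟩, le_refl ⟪x, u⟫, rfl⟩

lemma CondC4.continuous_measure_halfspace [IsProbabilityMeasure μ] (h : CondC4 μ f) :
    Continuous fun p : EuclideanSpace ℝ (Fin d) ×
        Metric.sphere (0 : EuclideanSpace ℝ (Fin d)) 1 =>
      μ.real {z | ⟪z, p.2.1⟫ ≤ ⟪p.1, p.2.1⟫} := by
  refine continuous_iff_continuousAt.2 fun p => ?_
  refine (ENNReal.tendsto_toReal (measure_ne_top μ _)).comp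
    (tendsto_measure_of_ae_tendsto_indicator_of_isFiniteMeasure _ ?_ (fun q => ?_) ?_)
  · exact measurableSet_le (by fun_prop) (by fun_prop)
  · exact measurableSet_le (by fun_prop) (by fun_prop)
  · have hnull : ∀ᵐ z ∂μ, ⟪z, p.2.1⟫ ≠ ⟪p.1, p.2.1⟫ := by
      rw [ae_iff]
      simpa using h.measure_hyperplane (by simp) ⟪p.1, p.2.1⟫
    filter_upwards [hnull] with z hz
    have h1 : Continuous fun q : EuclideanSpace ℝ (Fin d) ×
        Metric.sphere (0 : EuclideanSpace ℝ (Fin d)) 1 => ⟪z, q.2.1⟫ := by fun_prop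
    have h2 : Continuous fun q : EuclideanSpace ℝ (Fin d) ×
        Metric.sphere (0 : EuclideanSpace ℝ (Fin d)) 1 => ⟪q.1, q.2.1⟫ := by fun_prop
    rcases hz.lt_or_gt with hlt | hlt
    · filter_upwards [h1.continuousAt.eventually_lt h2.continuousAt hlt] with q hq
      exact iff_of_true hq.le hlt.le
    · filter_upwards [h2.continuousAt.eventually_lt h1.continuousAt hlt] with q hq
      exact iff_of_false (not_le.2 hq) (not_le.2 hlt)

lemma CondC4.continuous_halfspaceDepth [IsProbabilityMeasure μ]
    (h : CondC4 μ f) : Continuous (halfspaceDepth μ) := by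
  rw [funext halfspaceDepth_eq_sInf_sphere]
  exact isCompact_univ.continuous_sInf
    (f := fun x (u : Metric.sphere (0 : EuclideanSpace ℝ (Fin d)) 1) =>
      μ.real {z | ⟪z, u.1⟫ ≤ ⟪x, u.1⟫}) h.continuous_measure_halfspace

/-- A point of positive depth has a minimal halfspace. -/
lemma CondC4.exists_minimal_halfspace [IsProbabilityMeasure μ]
    (h : CondC4 μ f) {x : EuclideanSpace ℝ (Fin d)}
    (hx : 0 < halfspaceDepth μ x) :
    ∃ u : EuclideanSpace ℝ (Fin d), ‖u‖ = 1 ∧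
      halfspaceDepth μ x = μ.real {z | ⟪z, u⟫ ≤ ⟪x, u⟫} := by
  have hcont : Continuous fun u : Metric.sphere (0 : EuclideanSpace ℝ (Fin d)) 1 =>
      μ.real {z | ⟪z, u.1⟫ ≤ ⟪x, u.1⟫} := by
    have hpair : Continuous fun u : Metric.sphere (0 : EuclideanSpace ℝ (Fin d)) 1 => (x, u) := by
      fun_prop
    have hcomp := h.continuous_measure_halfspace.comp hpair
    simpa only [Function.comp_def] using hcomp
  rw [halfspaceDepth_eq_sInf_sphere] at hx ⊢
  have hne : ((fun u : Metric.sphere (0 : EuclideanSpace ℝ (Fin d)) 1 =>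
      μ.real {z | ⟪z, u.1⟫ ≤ ⟪x, u.1⟫}) '' univ).Nonempty := by
    by_contra hne
    rw [not_nonempty_iff_eq_empty.1 hne, Real.sInf_empty] at hx
    exact hx.false
  obtain ⟨u, -, hu⟩ := (isCompact_univ.image hcont).sInf_mem hne
  exact ⟨u.1, by simp, hu.symm⟩

lemma CondC4.hasFDerivAt_measure_halfspace [IsProbabilityMeasure μ]
    (h : CondC4 μ f) {u : EuclideanSpace ℝ (Fin d)}
    (hu : ‖u‖ = 1) (x : EuclideanSpace ℝ (Fin d)) :
    HasFDerivAt (fun y => μ.real {z | ⟪z, u⟫ ≤ ⟪y, u⟫})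
      (max (f u ⟪x, u⟫) 0 • innerSL ℝ u) x := by
  have hm : Measurable fun z : EuclideanSpace ℝ (Fin d) => ⟪z, u⟫ := by fun_prop
  have := Measure.isProbabilityMeasure_map (μ := μ) hm.aemeasurable
  have hderiv := hasDerivAt_measure_Iic (h.continuous_density hu) (h.1 u hu) ⟪x, u⟫
  have hinner : HasFDerivAt (fun y : EuclideanSpace ℝ (Fin d) => ⟪y, u⟫) (innerSL ℝ u) x := by
    refine (innerSL ℝ u).hasFDerivAt.congr_of_eventuallyEq (Eventually.of_forall fun y => ?_)
    exact real_inner_comm _ _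
  refine (hderiv.comp_hasFDerivAt x hinner).congr_of_eventuallyEq
    (Eventually.of_forall fun y => ?_)
  simp only [Function.comp, Measure.map_apply hm measurableSet_Iic]
  rfl

/-- The gradient of the depth at a point is an outer normal of any minimal halfspace there. -/
lemma CondC4.gradient_halfspaceDepth [IsProbabilityMeasure μ]
    (h : CondC4 μ f) {x u : EuclideanSpace ℝ (Fin d)}
    (hu : ‖u‖ = 1) (hxu : halfspaceDepth μ x = μ.real {z | ⟪z, u⟫ ≤ ⟪x, u⟫})
    (hdiff : DifferentiableAt ℝ (halfspaceDepth μ) x) :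
    gradient (halfspaceDepth μ) x = max (f u ⟪x, u⟫) 0 • u := by
  have hmin : IsLocalMin (fun y => μ.real {z | ⟪z, u⟫ ≤ ⟪y, u⟫} - halfspaceDepth μ y) x :=
    Eventually.of_forall fun y => by
      simpa [← hxu] using halfspaceDepth_le (μ := μ) y hu
  have hzero := hmin.hasFDerivAt_eq_zero
    ((h.hasFDerivAt_measure_halfspace hu x).sub hdiff.hasFDerivAt)
  refine ext_inner_right ℝ fun v => ?_
  have := DFunLike.congr_fun hzero v
  simp only [sub_apply, smul_apply, innerSL_apply_apply, zero_apply, sub_eq_zero] at this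
  rw [inner_gradient_left, ← this, inner_smul_left]
  rfl

lemma norm_gradient_eq (x : EuclideanSpace ℝ (Fin d)) :
    ‖gradient (halfspaceDepth μ) x‖ = ‖fderiv ℝ (halfspaceDepth μ) x‖ :=
  LinearIsometryEquiv.norm_map _ _

lemma CondC4.radonT_outerNormal [IsProbabilityMeasure μ]
    (h : CondC4 μ f) {x : EuclideanSpace ℝ (Fin d)}
    (hx : 0 < halfspaceDepth μ x) (hdiff : DifferentiableAt ℝ (halfspaceDepth μ) x)
    (hgrad : gradient (halfspaceDepth μ) x ≠ 0) :
    radonT f x (outerNormal μ x) = ‖fderiv ℝ (halfspaceDepth μ) x‖ := by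
  obtain ⟨u, hu, hxu⟩ := h.exists_minimal_halfspace hx
  have hg := h.gradient_halfspaceDepth hu hxu hdiff
  have hpos : 0 < f u ⟪x, u⟫ := by
    by_contra hle
    rw [max_eq_right (not_lt.1 hle), zero_smul] at hg
    exact hgrad hg
  rw [max_eq_left hpos.le] at hg
  have hnorm : ‖gradient (halfspaceDepth μ) x‖ = f u ⟪x, u⟫ := by
    rw [hg, norm_smul, hu, mul_one, Real.norm_of_nonneg hpos.le]
  have hout : outerNormal μ x = u := by
    rw [outerNormal, hnorm, hg, inv_smul_smul₀ hpos.ne']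
  rw [hout, ← norm_gradient_eq, hnorm, radonT]

lemma isBounded_trimmedRegion [IsProbabilityMeasure μ] {α : ℝ} (hα : 0 < α) :
    Bornology.IsBounded (trimmedRegion μ α) := by
  obtain ⟨K, hK, hμK⟩ := isTightMeasureSet_iff_exists_isCompact_measure_compl_le.1
    (isTightMeasureSet_singleton (μ := μ)) (ENNReal.ofReal (α / 2)) (by simpa using hα)
  obtain ⟨R, hR, hKR⟩ := hK.isBounded.exists_pos_norm_le
  refine isBounded_iff_forall_norm_le.2 ⟨R, fun x hx => ?_⟩
  by_contra! hlt
  have hx0 : ‖x‖ ≠ 0 := (hR.trans hlt).ne'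
  have hu : ‖(-‖x‖⁻¹) • x‖ = 1 := by
    rw [norm_smul, norm_neg, norm_inv, norm_norm, inv_mul_cancel₀ hx0]
  have hsub : {z | ⟪z, (-‖x‖⁻¹) • x⟫ ≤ ⟪x, (-‖x‖⁻¹) • x⟫} ⊆ Kᶜ := fun z hz hzK => by
    have h1 : ⟪x, (-‖x‖⁻¹) • x⟫ = -‖x‖ := by
      rw [real_inner_smul_right, real_inner_self_eq_norm_sq]
      field_simp
    have h2 := (abs_le.1 (abs_real_inner_le_norm z ((-‖x‖⁻¹) • x))).1
    rw [hu, mul_one] at h2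
    have h3 : ⟪z, (-‖x‖⁻¹) • x⟫ ≤ ⟪x, (-‖x‖⁻¹) • x⟫ := hz
    linarith [hKR z hzK]
  have hle : μ.real {z | ⟪z, (-‖x‖⁻¹) • x⟫ ≤ ⟪x, (-‖x‖⁻¹) • x⟫} ≤ α / 2 :=
    ENNReal.toReal_le_of_le_ofReal (by linarith) ((measure_mono hsub).trans (hμK μ rfl))
  have : α ≤ halfspaceDepth μ x := hx
  linarith [halfspaceDepth_le (μ := μ) x hu]

lemma CondC4.isCompact_trimmedRegion [IsProbabilityMeasure μ]
    (h : CondC4 μ f) {α : ℝ} (hα : 0 < α) :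
    IsCompact (trimmedRegion μ α) :=
  Metric.isCompact_of_isClosed_isBounded
    (isClosed_le continuous_const h.continuous_halfspaceDepth) (isBounded_trimmedRegion hα)

/-- The boundary of a trimmed region is a level set of the depth. -/
lemma CondC4.frontier_trimmedRegion [IsProbabilityMeasure μ]
    (h : CondC4 μ f) {α : ℝ} (hα0 : 0 < α) (hα1 : α < 1) :
    frontier (trimmedRegion μ α) = {x | halfspaceDepth μ x = α} := by
  refine Subset.antisymm ((frontier_le_subset_eq continuous_const
    h.continuous_halfspaceDepth).trans fun x hx => Eq.symm hx) fun x hx => ?_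
  replace hx : halfspaceDepth μ x = α := hx
  refine ⟨subset_closure hx.ge, fun hint => ?_⟩
  obtain ⟨u, hu, hxu⟩ := h.exists_minimal_halfspace (hα0.trans_eq hx.symm)
  have hm : Measurable fun z : EuclideanSpace ℝ (Fin d) => ⟪z, u⟫ := by fun_prop
  have hle : μ.real {z | ⟪z, u⟫ ≤ ⟪x, u⟫} = α := by rw [← hxu, hx]
  have hpos : 0 < f u ⟪x, u⟫ := by
    refine h.2.2 u hu _ ?_ ?_
    · rw [Measure.map_apply hm measurableSet_Iio, pos_iff_ne_zero]
      intro h0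
      have hsub : {z | ⟪z, u⟫ ≤ ⟪x, u⟫} ⊆
          (fun z => ⟪z, u⟫) ⁻¹' Iio ⟪x, u⟫ ∪ {z | ⟪z, u⟫ = ⟪x, u⟫} :=
        fun z (hz : ⟪z, u⟫ ≤ ⟪x, u⟫) => hz.lt_or_eq
      have := measure_mono_null hsub (measure_union_null h0 (h.measure_hyperplane hu _))
      rw [measureReal_def, this, ENNReal.toReal_zero] at hle
      exact hα0.ne hle
    · rw [Measure.map_apply hm measurableSet_Ioi, pos_iff_ne_zero]
      intro h0
      have hcompl : (fun z => ⟪z, u⟫) ⁻¹' Ioi ⟪x, u⟫ = {z | ⟪z, u⟫ ≤ ⟪x, u⟫}ᶜ := by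
        ext z
        simp
      rw [hcompl, prob_compl_eq_zero_iff (measurableSet_le (by fun_prop) (by fun_prop))] at h0
      rw [measureReal_def, h0, ENNReal.toReal_one] at hle
      exact hα1.ne' hle
  have hmin : IsLocalMin (fun y => μ.real {z | ⟪z, u⟫ ≤ ⟪y, u⟫}) x := by
    filter_upwards [mem_interior_iff_mem_nhds.1 hint] with y hy
    rw [hle]
    exact le_trans hy (halfspaceDepth_le y hu)
  have hzero := DFunLike.congr_fun
    (hmin.hasFDerivAt_eq_zero (h.hasFDerivAt_measure_halfspace hu x)) u
  rw [max_eq_left hpos.le, smul_apply, innerSL_apply_apply, real_inner_self_eq_norm_sq, hu] at hzero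
  simp [hpos.ne'] at hzero

end Depth

/-- Asymptotics of the Hausdorff distance between depth trimmed regions at nearby levels:
`ρ_H(R(α+t), R(α))/|t| → 1 / min_{x ∈ ∂R(α)} T_{x,u_x}μ` as `t → 0`. -/
theorem hausdorffDist_trimmedRegion_derivative
    {d : ℕ} (μ : Measure (EuclideanSpace ℝ (Fin d))) [IsProbabilityMeasure μ]
    (f : EuclideanSpace ℝ (Fin d) → ℝ → ℝ)
    (α : ℝ) (hα0 : 0 < α) (hα : α < depthMax μ)
    (hC3 : CondC3 μ α) (hC4 : CondC4 μ f) :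
    Tendsto (fun t : ℝ =>
        Metric.hausdorffDist (trimmedRegion μ (α + t)) (trimmedRegion μ α) / |t|)
      (nhdsWithin 0 {0}ᶜ)
      (nhds (1 / ⨅ x : frontier (trimmedRegion μ α),
        radonT f x.1 (outerNormal μ x.1))) := by
  have hex : ∃ p, α < halfspaceDepth μ p := exists_lt_of_lt_ciSup hα
  obtain ⟨p, hp⟩ := hex
  obtain ⟨u, hu, hpu⟩ := hC4.exists_minimal_halfspace (hα0.trans hp)
  have hα1 : α < 1 := hp.trans_le (hpu.trans_le measureReal_le_one)
  have : Nontrivial (EuclideanSpace ℝ (Fin d)) :=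
    ⟨u, 0, fun h => by simp [h] at hu⟩
  have hfr := hC4.frontier_trimmedRegion hα0 hα1
  have hcont := hC4.continuous_halfspaceDepth
  have hcpt := hC4.isCompact_trimmedRegion hα0
  obtain ⟨⟨U, hU, hfrU, hC1⟩, hgrad⟩ := hC3
  have hC1' : ∀ x ∈ frontier (trimmedRegion μ α), ContDiffAt ℝ 1 (halfspaceDepth μ) x :=
    fun x hx => hC1.contDiffAt (hU.mem_nhds (hfrU hx))
  have hradon : ∀ x : frontier (trimmedRegion μ α),
      radonT f x.1 (outerNormal μ x.1) = ‖fderiv ℝ (halfspaceDepth μ) x.1‖ := fun x =>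
    hC4.radonT_outerNormal (hα0.trans_eq (hfr.subset x.2).symm)
      ((hC1' x x.2).differentiableAt one_ne_zero) (hgrad x x.2)
  have hne : (frontier (trimmedRegion μ α)).Nonempty :=
    nonempty_frontier_iff.2 ⟨⟨p, hp.le⟩, fun h => NormedSpace.unbounded_univ ℝ
      (EuclideanSpace ℝ (Fin d)) (h ▸ hcpt.isBounded)⟩
  have hcptfr : IsCompact (frontier (trimmedRegion μ α)) :=
    hcpt.of_isClosed_subset isClosed_frontier hcpt.isClosed.frontier_subset
  obtain ⟨x₀, hx₀, hmin⟩ := hcptfr.exists_isMinOn hne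
    (f := fun x => ‖fderiv ℝ (halfspaceDepth μ) x‖) fun x hx =>
      ((hC1' x hx).continuousAt_fderiv one_ne_zero).norm.continuousWithinAt
  have hinf : ⨅ x : frontier (trimmedRegion μ α), radonT f x.1 (outerNormal μ x.1) =
      ‖fderiv ℝ (halfspaceDepth μ) x₀‖ := by
    simp_rw [hradon]
    have : Nonempty (frontier (trimmedRegion μ α)) := hne.to_subtype
    exact le_antisymm
      (ciInf_le (f := fun x : frontier (trimmedRegion μ α) =>
        ‖fderiv ℝ (halfspaceDepth μ) x.1‖) ⟨0, by rintro _ ⟨x, rfl⟩; positivity⟩ ⟨x₀, hx₀⟩)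
      (le_ciInf fun x => hmin x.2)
  rw [hinf]
  have hlevel : ∀ x, halfspaceDepth μ x = α → x ∈ frontier (trimmedRegion μ α) :=
    fun x hx => hfr.superset hx
  exact tendsto_hausdorffDist_superlevel_div hcont (half_lt_self hα0)
    (hC4.isCompact_trimmedRegion (half_pos hα0)) ⟨p, hp⟩
    (fun x hx => (hC1' x (hlevel x hx)).hasStrictFDerivAt one_ne_zero)
    (by rw [← norm_gradient_eq, norm_pos_iff]; exact hgrad x₀ hx₀)
    (fun x hx => hmin (hlevel x hx)) (hfr.subset hx₀) hx₀ rfl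

end
end

section
/- Let K be a convex body in ℝ^d, let μ be the uniform probability distribution on K, and let δ > 0 be such that the inner envelope K^{−δ} = {x : B_δ(x) ⊆ K} is nonempty. Then there exists a constant c > 0 depending only on K and δ such that for every y ∈ K^{−δ} and every unit vector u for which y + H_u is a minimal halfspace at y (i.e. μ(y + H_u) = D(y), where D is the halfspace depth of μ), one has μ(y + H_v) − μ(y + H_u) ≤ c‖v − u‖² for all unit vectors v. -/
open MeasureTheory Filter Set
open scoped RealInnerProductSpace ENNReal Topology

noncomputable section

/-- The inner `r`-envelope `K^{−r} = {x : B_r(x) ⊆ K}`. -/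
def innerEnvelope {d : ℕ} (K : Set (EuclideanSpace ℝ (Fin d))) (r : ℝ) :
    Set (EuclideanSpace ℝ (Fin d)) :=
  {x | Metric.closedBall x r ⊆ K}

theorem volume_real_slab_le {d : ℕ} {u : EuclideanSpace ℝ (Fin d)} (hu : ‖u‖ = 1) {s R : ℝ}
    (hs : 0 ≤ s) (hR : 0 ≤ R) :
    volume.real {z : EuclideanSpace ℝ (Fin d) | 0 ≤ ⟪z, u⟫ ∧ ⟪z, u⟫ ≤ s ∧ ‖z‖ ≤ R} ≤
      s * (2 * R) ^ (d - 1) := by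
  rcases d with _ | n
  · simp [Subsingleton.elim u 0] at hu
  have hon : Orthonormal ℝ
      (({0} : Set (Fin (n + 1))).domRestrict fun _ : Fin (n + 1) => u) := by
    refine ⟨fun i => hu, fun i j hij => ?_⟩
    exact absurd (Subsingleton.elim i j) hij
  obtain ⟨b, hb⟩ := hon.exists_orthonormalBasis_extension_of_card_eq (by simp)
  have hb0 : b 0 = u := hb 0 rfl
  let lo : Fin (n + 1) → ℝ := Fin.cons 0 fun _ => -R
  let hi : Fin (n + 1) → ℝ := Fin.cons s fun _ => R
  have hle : lo ≤ hi := by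
    intro i
    refine Fin.cases ?_ (fun j => ?_) i
    · simpa [lo, hi] using hs
    · simp only [lo, hi, Fin.cons_succ]; linarith
  have hmp := (PiLp.volume_preserving_ofLp (Fin (n + 1))).comp b.measurePreserving_repr
  have hpre := hmp.measureReal_preimage (measurableSet_Icc (a := lo) (b := hi)).nullMeasurableSet
  have hvol : volume.real (Icc lo hi) = s * (2 * R) ^ n := by
    rw [measureReal_def, Real.volume_Icc_pi_toReal hle, Fin.prod_univ_succ]
    simp [lo, hi, two_mul]
  rw [Nat.add_sub_cancel, ← hvol, ← hpre]
  refine measureReal_mono ?_ ?_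
  · rintro z ⟨h0, h1, h2⟩
    have key : ∀ i, |b.repr z i| ≤ R := fun i => by
      rw [b.repr_apply_apply]
      calc |⟪b i, z⟫| ≤ ‖b i‖ * ‖z‖ := abs_real_inner_le_norm _ _
        _ ≤ R := by simpa using h2
    have key0 : b.repr z 0 = ⟪z, u⟫ := by rw [b.repr_apply_apply, hb0, real_inner_comm]
    refine ⟨fun i => ?_, fun i => ?_⟩
    · refine Fin.cases ?_ (fun j => ?_) i
      · simpa [lo, key0] using h0
      · simpa [lo] using (abs_le.1 (key j.succ)).1
    · refine Fin.cases ?_ (fun j => ?_) i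
      · simpa [hi, key0] using h1
      · simpa [hi] using (abs_le.1 (key j.succ)).2
  · rw [hmp.measure_preimage measurableSet_Icc.nullMeasurableSet]
    exact isCompact_Icc.measure_lt_top.ne

theorem measurableSet_inner_le {d : ℕ} (v : EuclideanSpace ℝ (Fin d)) (t : ℝ) :
    MeasurableSet {z : EuclideanSpace ℝ (Fin d) | ⟪z, v⟫ ≤ t} :=
  (isClosed_le (by fun_prop) continuous_const).measurableSet

theorem volume_inner_eq_zero {d : ℕ} {v : EuclideanSpace ℝ (Fin d)} (hv : ‖v‖ = 1) :
    volume {z : EuclideanSpace ℝ (Fin d) | ⟪z, v⟫ = 0} = 0 := by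
  have h : {z : EuclideanSpace ℝ (Fin d) | ⟪z, v⟫ = 0} = ((ℝ ∙ v)ᗮ : Submodule ℝ _) := by
    ext z
    simp [Submodule.mem_orthogonal_singleton_iff_inner_left]
  rw [h]
  refine Measure.addHaar_submodule _ _ fun htop => ?_
  have hmem : v ∈ (ℝ ∙ v)ᗮ := htop ▸ Submodule.mem_top
  rw [Submodule.mem_orthogonal_singleton_iff_inner_left, real_inner_self_eq_norm_sq, hv] at hmem
  norm_num at hmem

theorem reflection_span_unit {d : ℕ} {u : EuclideanSpace ℝ (Fin d)} (hu : ‖u‖ = 1)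
    (z : EuclideanSpace ℝ (Fin d)) :
    (ℝ ∙ u).reflection z = (2 * ⟪z, u⟫) • u - z := by
  rw [Submodule.reflection_singleton_apply, hu, real_inner_comm,
    ← Nat.cast_smul_eq_nsmul ℝ, smul_smul]
  simp

theorem norm_reflection_span_unit_sub {d : ℕ} {u : EuclideanSpace ℝ (Fin d)} (hu : ‖u‖ = 1)
    (v : EuclideanSpace ℝ (Fin d)) :
    ‖(ℝ ∙ u).reflection v - u‖ = ‖v - u‖ := by
  have h : (ℝ ∙ u).reflection u = u := by
    rw [reflection_span_unit hu, real_inner_self_eq_norm_sq, hu, one_pow, mul_one, two_smul, add_sub_cancel_right]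
  rw [← (ℝ ∙ u).reflection.norm_map (v - u), map_sub, h]

/-- Reflecting a point of a convex set containing `closedBall 0 δ` in the hyperplane `uᗮ` and then
shrinking slightly brings it back into the set. -/
theorem smul_reflection_mem {d : ℕ} {L : Set (EuclideanSpace ℝ (Fin d))} (hL : Convex ℝ L)
    {δ ε : ℝ} (hball : Metric.closedBall 0 δ ⊆ L) (hε : 0 < ε) (hε1 : ε ≤ 1)
    {u z : EuclideanSpace ℝ (Fin d)} (hu : ‖u‖ = 1) (hz : z ∈ L) (h : 2 * |⟪z, u⟫| ≤ ε * δ) :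
    (-(1 - ε)) • (ℝ ∙ u).reflection z ∈ L := by
  have hp : (-((1 - ε) * (2 * ⟪z, u⟫) / ε)) • u ∈ L := by
    apply hball
    rw [mem_closedBall_zero_iff, norm_smul, hu, mul_one, norm_neg, Real.norm_eq_abs, abs_div,
      abs_mul, abs_mul, abs_of_pos hε, abs_two, abs_of_nonneg (by linarith : 0 ≤ 1 - ε),
      div_le_iff₀ hε]
    nlinarith [abs_nonneg ⟪z, u⟫]
  have := hL hz hp (by linarith : 0 ≤ 1 - ε) hε.le (by ring)
  convert this using 1
  rw [reflection_span_unit hu, smul_smul, smul_sub, smul_smul, neg_smul (1 - ε) z, sub_neg_eq_add,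
    add_comm]
  congr 2
  field_simp

open scoped Pointwise in
theorem volume_real_smul_image_le {d : ℕ} {W W' : Set (EuclideanSpace ℝ (Fin d))}
    (hW : MeasurableSet W) (hW' : volume W' ≠ ∞) {r : ℝ}
    (f : EuclideanSpace ℝ (Fin d) ≃ₗᵢ[ℝ] EuclideanSpace ℝ (Fin d))
    (h : ∀ z ∈ W, r • f z ∈ W') :
    |r| ^ d * volume.real W ≤ volume.real W' := by
  have hsub : r • (f '' W) ⊆ W' := by
    rintro _ ⟨_, ⟨z, hz, rfl⟩, rfl⟩
    exact h z hz
  have himg : volume (f '' W) = volume W := by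
    rw [f.image_eq_preimage_symm, f.symm.measurePreserving.measure_preimage hW.nullMeasurableSet]
  have := measureReal_mono hsub hW'
  rwa [measureReal_def, Measure.addHaar_smul, himg, ENNReal.toReal_mul,
    ENNReal.toReal_ofReal (abs_nonneg _), abs_pow, finrank_euclideanSpace_fin,
    ← measureReal_def] at this

theorem volume_real_wedge_sub_le {d : ℕ} {L : Set (EuclideanSpace ℝ (Fin d))} (hL : Convex ℝ L)
    (hLm : MeasurableSet L) {δ R : ℝ} (hδ : 0 < δ) (hR : 0 < R)
    (hball : Metric.closedBall 0 δ ⊆ L) (hLR : L ⊆ Metric.closedBall 0 R)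
    {u v : EuclideanSpace ℝ (Fin d)} (hu : ‖u‖ = 1) (hv : ‖v‖ = 1) (huv : v ≠ u) :
    volume.real ((L ∩ {z | ⟪z, v⟫ ≤ 0}) \ {z | ⟪z, u⟫ ≤ 0}) -
        volume.real ((L ∩ {z | ⟪z, u⟫ ≤ 0}) \ {z | ⟪z, (ℝ ∙ u).reflection v⟫ ≤ 0}) ≤
      d * (2 * R / δ) * (R * (2 * R) ^ (d - 1)) * ‖v - u‖ ^ 2 := by
  set t := ‖v - u‖ with ht
  have ht0 : 0 < t := norm_pos_iff.2 (sub_ne_zero.2 huv)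
  set ε := 2 * R / δ * t with hεdef
  have hε : 0 < ε := by positivity
  have hLfin : volume L ≠ ∞ :=
    ((measure_mono hLR).trans_lt measure_closedBall_lt_top).ne
  have hd : (1 : ℝ) ≤ d := by
    rcases d with _ | n
    · simp [Subsingleton.elim u 0] at hu
    · push_cast; linarith [(Nat.cast_nonneg n : (0 : ℝ) ≤ n)]
  set W := (L ∩ {z | ⟪z, v⟫ ≤ 0}) \ {z | ⟪z, u⟫ ≤ 0} with hWdef
  set W' := (L ∩ {z | ⟪z, u⟫ ≤ 0}) \ {z | ⟪z, (ℝ ∙ u).reflection v⟫ ≤ 0} with hW'def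
  have hWm : MeasurableSet W :=
    (hLm.inter (measurableSet_inner_le v 0)).diff (measurableSet_inner_le u 0)
  have hWt : ∀ z ∈ W, ⟪z, u⟫ ≤ R * t := by
    rintro z ⟨⟨hzL, hzv⟩, -⟩
    have hzR : ‖z‖ ≤ R := by simpa using hLR hzL
    have h1 : ⟪z, u⟫ - ⟪z, v⟫ ≤ ‖z‖ * ‖u - v‖ := by
      rw [← inner_sub_right]; exact real_inner_le_norm _ _
    rw [norm_sub_rev, ← ht] at h1
    have h2 : ‖z‖ * t ≤ R * t := by gcongr
    simp only [mem_ofPred_eq] at hzv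
    linarith
  have hWvol : volume.real W ≤ R * t * (2 * R) ^ (d - 1) := by
    refine le_trans (measureReal_mono ?_ ?_) (volume_real_slab_le hu (by positivity) hR.le)
    · intro z hz
      refine ⟨(not_le.1 hz.2).le, hWt z hz, by simpa using hLR hz.1.1⟩
    · refine ((measure_mono ?_).trans_lt (measure_closedBall_lt_top (x := 0) (r := R))).ne
      rintro z ⟨-, -, h⟩
      simpa using h
  have hmain : volume.real W - volume.real W' ≤ d * ε * volume.real W := by
    have hW0 : 0 ≤ volume.real W := measureReal_nonneg
    have hW'0 : 0 ≤ volume.real W' := measureReal_nonneg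
    rcases le_or_gt 1 ε with h1 | h1
    · have : 1 * 1 ≤ d * ε := mul_le_mul hd h1 zero_le_one (by linarith)
      nlinarith
    set W₀ := W ∩ {z | ⟪z, v⟫ ≠ 0} with hW₀def
    have hW₀ : volume.real W₀ = volume.real W := by
      refine measureReal_congr ?_
      have hae : ∀ᵐ z ∂(volume : Measure (EuclideanSpace ℝ (Fin d))), ⟪z, v⟫ ≠ 0 := by
        rw [ae_iff]; simpa using volume_inner_eq_zero hv
      filter_upwards [hae] with z hz
      exact propext ⟨fun h => h.1, fun h => ⟨h, hz⟩⟩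
    have hW₀m : MeasurableSet W₀ := hWm.inter
      (isOpen_ne_fun (by fun_prop) continuous_const).measurableSet
    have hmap : ∀ z ∈ W₀, (-(1 - ε)) • (ℝ ∙ u).reflection z ∈ W' := by
      rintro z ⟨hz, hzv'⟩
      have hzu : 0 < ⟪z, u⟫ := not_le.1 hz.2
      have hzv : ⟪z, v⟫ < 0 := lt_of_le_of_ne hz.1.2 hzv'
      refine ⟨⟨smul_reflection_mem hL hball hε h1.le hu hz.1.1 ?_, ?_⟩, ?_⟩
      · have := hWt z hz
        rw [abs_of_pos hzu, hεdef, show 2 * R / δ * t * δ = 2 * (R * t) by field_simp]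
        linarith
      · have : ⟪(ℝ ∙ u).reflection z, u⟫ = ⟪z, u⟫ := by
          rw [reflection_span_unit hu, inner_sub_left, inner_smul_left, real_inner_self_eq_norm_sq,
            hu]
          simp; ring
        rw [mem_ofPred_eq, inner_smul_left, this]
        simp only [conj_trivial]
        nlinarith
      · rw [mem_ofPred_eq, inner_smul_left, LinearIsometryEquiv.inner_map_map]
        simp only [conj_trivial]
        nlinarith
    have := volume_real_smul_image_le hW₀m
      (measure_ne_top_of_subset (fun z hz => hz.1.1 : W' ⊆ L) hLfin) _ hmap
    rw [hW₀, abs_neg, abs_of_pos (by linarith : 0 < 1 - ε)] at this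
    have hbern := one_add_mul_le_pow (by linarith : -2 ≤ -ε) d
    rw [← sub_eq_add_neg] at hbern
    nlinarith [mul_le_mul_of_nonneg_right hbern hW0]
  calc volume.real W - volume.real W' ≤ d * ε * volume.real W := hmain
    _ ≤ d * ε * (R * t * (2 * R) ^ (d - 1)) := by gcongr
    _ = _ := by rw [hεdef]; ring

/-- Adding the wedge estimates for `v` and its mirror image gives a bound for the symmetric second
difference of the volume cut off by a halfspace. -/
theorem volume_real_second_difference_le {d : ℕ} {L : Set (EuclideanSpace ℝ (Fin d))}
    (hL : Convex ℝ L) (hLm : MeasurableSet L) {δ R : ℝ} (hδ : 0 < δ) (hR : 0 < R)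
    (hball : Metric.closedBall 0 δ ⊆ L) (hLR : L ⊆ Metric.closedBall 0 R)
    {u v : EuclideanSpace ℝ (Fin d)} (hu : ‖u‖ = 1) (hv : ‖v‖ = 1) (huv : v ≠ u) :
    volume.real (L ∩ {z | ⟪z, v⟫ ≤ 0}) + volume.real (L ∩ {z | ⟪z, (ℝ ∙ u).reflection v⟫ ≤ 0}) -
        2 * volume.real (L ∩ {z | ⟪z, u⟫ ≤ 0}) ≤
      2 * (d * (2 * R / δ) * (R * (2 * R) ^ (d - 1))) * ‖v - u‖ ^ 2 := by
  have hLfin : volume L ≠ ∞ :=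
    ((measure_mono hLR).trans_lt measure_closedBall_lt_top).ne
  have hv' : ‖(ℝ ∙ u).reflection v‖ = 1 := by rw [LinearIsometryEquiv.norm_map, hv]
  have hnorm := norm_reflection_span_unit_sub hu v
  have huv' : (ℝ ∙ u).reflection v ≠ u := by
    rw [← sub_ne_zero, ← norm_ne_zero_iff, hnorm, norm_ne_zero_iff, sub_ne_zero]
    exact huv
  have h1 := volume_real_wedge_sub_le hL hLm hδ hR hball hLR hu hv huv
  have h2 := volume_real_wedge_sub_le hL hLm hδ hR hball hLR hu hv' huv'
  rw [Submodule.reflection_reflection, hnorm] at h2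
  have split : ∀ a b : EuclideanSpace ℝ (Fin d),
      volume.real (L ∩ {z | ⟪z, a⟫ ≤ 0} ∩ {z | ⟪z, b⟫ ≤ 0}) +
        volume.real ((L ∩ {z | ⟪z, a⟫ ≤ 0}) \ {z | ⟪z, b⟫ ≤ 0}) =
      volume.real (L ∩ {z | ⟪z, a⟫ ≤ 0}) := fun a b =>
    measureReal_inter_add_sdiff (measurableSet_inner_le b 0)
      (measure_ne_top_of_subset inter_subset_left hLfin)
  have e1 := split v u
  have e2 := split u v
  have e3 := split ((ℝ ∙ u).reflection v) u
  have e4 := split u ((ℝ ∙ u).reflection v)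
  rw [inter_right_comm] at e1 e3
  linarith

theorem halfspaceDepth_le_s18 {d : ℕ} (μ : Measure (EuclideanSpace ℝ (Fin d)))
    (y : EuclideanSpace ℝ (Fin d)) {v : EuclideanSpace ℝ (Fin d)} (hv : ‖v‖ = 1) :
    halfspaceDepth μ y ≤ (μ {z | ⟪z - y, v⟫ ≤ 0}).toReal := by
  refine csInf_le ⟨0, ?_⟩ ⟨_, ⟨v, ⟪y, v⟫, hv, rfl⟩, le_refl ⟪y, v⟫, ?_⟩
  · rintro r ⟨H, -, -, rfl⟩
    exact ENNReal.toReal_nonneg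
  · simp only [inner_sub_left, sub_nonpos]

/-- Second-order behaviour of the measure of halfspaces at a point as a function of the
normal direction: if `y + H_u` is a minimal halfspace at `y ∈ K^{−δ}`, then
`μ(y + H_v) − μ(y + H_u) ≤ c ‖v − u‖²` for all unit vectors `v`. -/
theorem measure_halfspace_second_order
    {d : ℕ} (K : Set (EuclideanSpace ℝ (Fin d)))
    (hKconv : Convex ℝ K) (hKcomp : IsCompact K) (hKint : (interior K).Nonempty)
    (μ : Measure (EuclideanSpace ℝ (Fin d)))
    (hμ : μ = (volume K)⁻¹ • volume.restrict K)
    (δ : ℝ) (hδ : 0 < δ) (hne : (innerEnvelope K δ).Nonempty) :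
    ∃ c : ℝ, 0 < c ∧
      ∀ y ∈ innerEnvelope K δ, ∀ u : EuclideanSpace ℝ (Fin d), ‖u‖ = 1 →
        (μ {z | ⟪z - y, u⟫ ≤ 0}).toReal = halfspaceDepth μ y →
        ∀ v : EuclideanSpace ℝ (Fin d), ‖v‖ = 1 →
          (μ {z | ⟪z - y, v⟫ ≤ 0}).toReal - (μ {z | ⟪z - y, u⟫ ≤ 0}).toReal ≤
            c * ‖v - u‖ ^ 2 := by
  set R := Metric.diam K + 1 with hRdef
  have hR : 0 < R := by positivity
  set C := 2 * (d * (2 * R / δ) * (R * (2 * R) ^ (d - 1))) with hC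
  have hC0 : 0 ≤ C := by positivity
  refine ⟨(volume K).toReal⁻¹ * C + 1, by positivity, fun y hy u hu hmin v hv => ?_⟩
  rcases eq_or_ne v u with rfl | huv
  · simp
  set L := (fun z => y + z) ⁻¹' K with hLdef
  have hLconv : Convex ℝ L := hKconv.translate_preimage_right y
  have hLm : MeasurableSet L := hKcomp.measurableSet.preimage (measurable_const_add y)
  have hball : Metric.closedBall 0 δ ⊆ L := fun z hz => hy (by simpa using hz)
  have hyK : y ∈ K := hy (Metric.mem_closedBall_self hδ.le)
  have hLR : L ⊆ Metric.closedBall 0 R := fun z hz => by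
    have := Metric.dist_le_diam_of_mem hKcomp.isBounded hz hyK
    simp only [dist_self_add_left] at this
    rw [mem_closedBall_zero_iff]; linarith
  have hval : ∀ w : EuclideanSpace ℝ (Fin d), (μ {z | ⟪z - y, w⟫ ≤ 0}).toReal =
      (volume K).toReal⁻¹ * volume.real (L ∩ {z | ⟪z, w⟫ ≤ 0}) := fun w => by
    have hpre : L ∩ {z | ⟪z, w⟫ ≤ 0} = (fun z => y + z) ⁻¹' ({z | ⟪z - y, w⟫ ≤ 0} ∩ K) := by
      ext z
      simp [hLdef, and_comm]
    rw [hpre, measureReal_def, measure_preimage_add, hμ, Measure.smul_apply,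
      Measure.restrict_apply' hKcomp.measurableSet, smul_eq_mul, ENNReal.toReal_mul,
      ENNReal.toReal_inv]
  have hsd := volume_real_second_difference_le hLconv hLm hδ hR hball hLR hu hv huv
  have hdep := halfspaceDepth_le_s18 μ y (v := (ℝ ∙ u).reflection v)
    (by rw [LinearIsometryEquiv.norm_map, hv])
  rw [← hmin, hval, hval] at hdep
  rw [hval, hval]
  have hinv : 0 ≤ (volume K).toReal⁻¹ := by positivity
  have := mul_le_mul_of_nonneg_left hsd hinv
  nlinarith [sq_nonneg ‖v - u‖]

end
end
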